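/- arXiv:1902.06234 — 7 statements merged into one kernel-verified Lean document; each statement's English description precedes it below -/
import Mathlib

section
/- For every positive integer n and every permutation w of {1,…,n}, the sum of (j−i) over all inversions (i,j) of w equals the sum over i from 1 to n of i·(i−w(i)), computed in the integers. That is, Σ_{(i,j)∈N(w)} (j−i) = Σ_{i=1}^{n} i(i−w(i)). -/
theorem sum_ite_apply_lt_apply {n : ℕ} (v : Equiv.Perm (Fin n)) (i : Fin n) :
    ∑ j : Fin n, (if v j < v i then (1 : ℤ) else 0) = (v i : ℤ) := by
  rw [Equiv.sum_comp v (fun j => if j < v i then (1 : ℤ) else 0), Finset.sum_boole,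
    Finset.filter_gt_eq_Iio, Fin.card_Iio]

theorem sum_ite_apply_gt_apply {n : ℕ} (v : Equiv.Perm (Fin n)) (j : Fin n) :
    ∑ i : Fin n, (if v j < v i then (1 : ℤ) else 0) = (n : ℤ) - 1 - (v j : ℤ) := by
  rw [Equiv.sum_comp v (fun i => if v j < i then (1 : ℤ) else 0), Finset.sum_boole,
    Finset.filter_lt_eq_Ioi, Fin.card_Ioi]
  have := (v j).isLt
  omega

/-- The differences `j - i` summed over all ordered pairs with `v j < v i`. -/
theorem sum_sum_sub_mul_ite {n : ℕ} (v : Equiv.Perm (Fin n)) :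
    ∑ i : Fin n, ∑ j : Fin n, ((j : ℤ) - (i : ℤ)) * (if v j < v i then (1 : ℤ) else 0)
      = ∑ i : Fin n, (i : ℤ) * ((n : ℤ) - 1 - 2 * (v i : ℤ)) := by
  simp only [sub_mul, Finset.sum_sub_distrib]
  rw [Finset.sum_comm]
  simp only [← Finset.mul_sum, sum_ite_apply_lt_apply, sum_ite_apply_gt_apply]
  rw [← Finset.sum_sub_distrib]
  exact Finset.sum_congr rfl fun i _ => by ring

/-- The inversion differences of `v`, in terms of the correlation of `v` with the identity. -/
theorem sum_inversions_sub {n : ℕ} (v : Equiv.Perm (Fin n)) :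
    ∑ p ∈ Finset.univ.filter (fun p : Fin n × Fin n => p.1 < p.2 ∧ v p.2 < v p.1),
      ((p.2 : ℤ) - (p.1 : ℤ))
      = ∑ i : Fin n, (i : ℤ) * ((i : ℤ) - (v i : ℤ)) := by
  rw [Finset.sum_filter, Fintype.sum_prod_type]
  dsimp only
  set f : Fin n → Fin n → ℤ :=
    fun i j => if i < j ∧ v j < v i then (j : ℤ) - (i : ℤ) else 0 with hf
  have symm_add (i j : Fin n) : f i j + f j i
      = ((j : ℤ) - (i : ℤ)) * (if v j < v i then (1 : ℤ) else 0)
        - ((j : ℤ) - (i : ℤ)) * (if j < i then (1 : ℤ) else 0) := by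
    simp only [hf]
    rcases lt_trichotomy i j with h | rfl | h
    · simp [h, h.not_gt]
    · simp
    · rcases lt_trichotomy (v i) (v j) with hv | hv | hv
      · simp [h, h.not_gt, hv, hv.not_gt]
      · exact absurd (v.injective hv) h.ne'
      · simp [h, h.not_gt, hv, hv.not_gt]
  have double : 2 * ∑ i, ∑ j, f i j
      = 2 * ∑ i : Fin n, (i : ℤ) * ((i : ℤ) - (v i : ℤ)) := by
    calc 2 * ∑ i, ∑ j, f i j = ∑ i, ∑ j, (f i j + f j i) := by
          simp only [Finset.sum_add_distrib]
          rw [Finset.sum_comm (f := fun i j => f j i), two_mul]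
      _ = _ := by
          have hid : ∑ i : Fin n, ∑ j : Fin n,
              ((j : ℤ) - (i : ℤ)) * (if j < i then (1 : ℤ) else 0)
              = ∑ i : Fin n, (i : ℤ) * ((n : ℤ) - 1 - 2 * (i : ℤ)) :=
            sum_sum_sub_mul_ite (Equiv.refl (Fin n))
          simp only [symm_add, Finset.sum_sub_distrib]
          rw [sum_sum_sub_mul_ite v, hid, ← Finset.sum_sub_distrib, Finset.mul_sum]
          exact Finset.sum_congr rfl fun i _ => by ring
  exact mul_left_cancel₀ two_ne_zero double

/-- For every positive integer n and every permutation w of {1,…,n},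
Σ_{(i,j)∈N(w)} (j−i) = Σ_{i=1}^{n} i·(i−w(i)) in ℤ.
We index by `Fin n` (0-indexed), so the 1-indexed value `i` corresponds to `(i : ℤ) + 1`
and `i − w(i)` is unchanged under the shift. -/
theorem signed_bigrassmannian_stmt0 (n : ℕ) (hn : 0 < n) (w : Equiv.Perm (Fin n)) :
    ∑ p ∈ Finset.univ.filter
        (fun p : Fin n × Fin n => p.1 < p.2 ∧ w⁻¹ p.2 < w⁻¹ p.1),
      ((p.2 : ℤ) - (p.1 : ℤ))
      = ∑ i : Fin n, ((i : ℤ) + 1) * ((i : ℤ) - (w i : ℤ)) := by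
  rw [sum_inversions_sub w⁻¹]
  have hsum : ∑ i : Fin n, (w i : ℤ) = ∑ i : Fin n, (i : ℤ) :=
    Equiv.sum_comp w (fun i => (i : ℤ))
  have hcorr : ∑ i : Fin n, (i : ℤ) * ((w⁻¹ i : Fin n) : ℤ)
      = ∑ i : Fin n, (i : ℤ) * (w i : ℤ) := by
    rw [← Equiv.sum_comp w]
    simp [mul_comm]
  simp only [mul_sub, add_mul, one_mul, Finset.sum_sub_distrib, Finset.sum_add_distrib,
    hsum, hcorr]
  ring
end

section
/- For every positive integer n and every permutation w of {1,…,n}, twice the sum of (j−i) over all inversions (i,j) of w equals Σ_{i=1}^{n} (i−w(i))², computed in the integers. That is, 2·β(w) = Σ_{i=1}^{n} (i−w(i))². -/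
/-- Summing `j - i` over all ordered pairs with `v j < v i` counts each index by the number of
values above it minus the number of values below it. -/
theorem sum_sub_of_perm_lt {n : ℕ} (v : Equiv.Perm (Fin n)) :
    ∑ i : Fin n, ∑ j : Fin n, (if v j < v i then ((j : ℤ) - (i : ℤ)) else 0)
      = ∑ i : Fin n, (i : ℤ) * ((n : ℤ) - 1 - 2 * (v i : ℤ)) := by
  have above (j : Fin n) :
      ∑ i : Fin n, (if v j < v i then (j : ℤ) else 0) = (j : ℤ) * ((n : ℤ) - 1 - (v j : ℤ)) := by
    rw [Equiv.sum_comp v (fun k => if v j < k then (j : ℤ) else 0), ← Finset.sum_filter,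
      Finset.sum_const, Finset.filter_lt_eq_Ioi, Fin.card_Ioi, nsmul_eq_mul]
    have := (v j).isLt
    rw [Nat.sub_sub, Nat.cast_sub (by lia)]
    push_cast
    ring
  have below (i : Fin n) :
      ∑ j : Fin n, (if v j < v i then (i : ℤ) else 0) = (i : ℤ) * (v i : ℤ) := by
    rw [Equiv.sum_comp v (fun k => if k < v i then (i : ℤ) else 0), ← Finset.sum_filter,
      Finset.sum_const, Finset.filter_gt_eq_Iio, Fin.card_Iio, nsmul_eq_mul, mul_comm]
  have split (i j : Fin n) : (if v j < v i then ((j : ℤ) - (i : ℤ)) else 0)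
      = (if v j < v i then (j : ℤ) else 0) - (if v j < v i then (i : ℤ) else 0) := by
    split_ifs <;> simp
  simp_rw [split, Finset.sum_sub_distrib, below]
  rw [Finset.sum_comm]
  simp_rw [above]
  rw [← Finset.sum_sub_distrib]
  exact Finset.sum_congr rfl fun i _ => by ring

/-- Twice the inversion sum, as a difference of sums over all ordered pairs. -/
theorem two_mul_sum_inversions {n : ℕ} (v : Equiv.Perm (Fin n)) :
    2 * ∑ p ∈ Finset.univ.filter (fun p : Fin n × Fin n => p.1 < p.2 ∧ v p.2 < v p.1),
      ((p.2 : ℤ) - (p.1 : ℤ))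
      = ∑ i : Fin n, ∑ j : Fin n, (if v j < v i then ((j : ℤ) - (i : ℤ)) else 0)
        - ∑ i : Fin n, ∑ j : Fin n, (if j < i then ((j : ℤ) - (i : ℤ)) else 0) := by
  rw [Finset.sum_filter, Fintype.sum_prod_type, two_mul]
  nth_rewrite 2 [Finset.sum_comm]
  simp_rw [← Finset.sum_add_distrib, ← Finset.sum_sub_distrib]
  refine Finset.sum_congr rfl fun i _ => Finset.sum_congr rfl fun j _ => ?_
  rcases lt_trichotomy i j with h | rfl | h
  · simp [h, h.not_gt]
  · simp
  · have hv : v j ≠ v i := fun e => h.ne (v.injective e)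
    rcases lt_or_gt_of_ne hv with h' | h' <;> simp [h, h.not_gt, h', h'.not_gt]

/-- For every positive integer n and every permutation w of {1,…,n},
2·β(w) = Σ_{i=1}^{n} (i−w(i))² in ℤ, where β(w) = Σ_{(i,j)∈N(w)} (j−i). -/
theorem signed_bigrassmannian_stmt1 (n : ℕ) (hn : 0 < n) (w : Equiv.Perm (Fin n)) :
    2 * ∑ p ∈ Finset.univ.filter
        (fun p : Fin n × Fin n => p.1 < p.2 ∧ w⁻¹ p.2 < w⁻¹ p.1),
      ((p.2 : ℤ) - (p.1 : ℤ))
      = ∑ i : Fin n, ((i : ℤ) - (w i : ℤ)) ^ 2 := by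
  have identity_sum :
      ∑ i : Fin n, ∑ j : Fin n, (if j < i then ((j : ℤ) - (i : ℤ)) else 0)
        = ∑ i : Fin n, (i : ℤ) * ((n : ℤ) - 1 - 2 * (i : ℤ)) :=
    sum_sub_of_perm_lt (Equiv.refl (Fin n))
  rw [two_mul_sum_inversions, sum_sub_of_perm_lt, identity_sum, ← Finset.sum_sub_distrib,
    ← Equiv.sum_comp w]
  have squares := Equiv.sum_comp w (fun i : Fin n => (i : ℤ) ^ 2)
  simp only [Equiv.Perm.inv_def, Equiv.symm_apply_apply]
  rw [← sub_eq_zero, ← Finset.sum_sub_distrib]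
  rw [← sub_eq_zero, ← Finset.sum_sub_distrib] at squares
  rw [← squares]
  exact Finset.sum_congr rfl fun i _ => by ring
end

section
/- For every positive integer n and every permutation w of {1,…,n}, β(w) = β(w⁻¹), where β(w) = Σ_{(i,j)∈N(w)} (j−i). -/
/-- The bigrassmannian statistic β(w) = Σ_{(i,j)∈N(w)} (j−i), where
N(w) = {(i,j) : i < j and w⁻¹(i) > w⁻¹(j)}. -/
def permBeta {n : ℕ} (w : Equiv.Perm (Fin n)) : ℕ :=
  ∑ p ∈ Finset.univ.filter
      (fun p : Fin n × Fin n => p.1 < p.2 ∧ w⁻¹ p.2 < w⁻¹ p.1),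
    ((p.2 : ℕ) - (p.1 : ℕ))

open Finset in
/-- Counting the elements below `j` by position and by value. -/
theorem sum_inversion_indicator_sub {n : ℕ} (u : Equiv.Perm (Fin n)) (j : Fin n) :
    ∑ i, ((if i < j ∧ u j < u i then (1 : ℤ) else 0) - if j < i ∧ u i < u j then 1 else 0)
      = (j : ℤ) - (u j : ℤ) := by
  have below (k : Fin n) : ∑ i : Fin n, (if i < k then (1 : ℤ) else 0) = (k : ℤ) := by
    rw [sum_boole, filter_gt_eq_Iio, Fin.card_Iio]
  have hu : ∑ i : Fin n, (if u i < u j then (1 : ℤ) else 0) = (u j : ℤ) := by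
    rw [← below (u j)]
    exact Equiv.sum_comp u fun i => if i < u j then (1 : ℤ) else 0
  rw [← below j, ← hu, ← sum_sub_distrib]
  refine sum_congr rfl fun i _ => ?_
  rcases lt_trichotomy i j with h | rfl | h
  · rcases lt_or_gt_of_ne (u.injective.ne h.ne) with h' | h' <;>
      simp [h, h', h.not_gt, h'.not_gt]
  · simp
  · rcases lt_or_gt_of_ne (u.injective.ne h.ne) with h' | h' <;>
      simp [h, h', h.not_gt, h'.not_gt]

open Finset in
theorem sum_inversions_sub_s2 {n : ℕ} (u : Equiv.Perm (Fin n)) (f : Fin n → ℤ) :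
    ∑ i, ∑ j, (if i < j ∧ u j < u i then f j - f i else 0)
      = ∑ j, f j * ((j : ℤ) - (u j : ℤ)) := by
  have hsplit (i j : Fin n) : (if i < j ∧ u j < u i then f j - f i else 0)
      = f j * (if i < j ∧ u j < u i then 1 else 0)
        - f i * (if i < j ∧ u j < u i then 1 else 0) := by
    split_ifs <;> ring
  simp_rw [hsplit, sum_sub_distrib]
  rw [sum_comm, ← sum_sub_distrib]
  refine sum_congr rfl fun j _ => ?_
  rw [← sum_inversion_indicator_sub, sum_sub_distrib, mul_sub, mul_sum, mul_sum]

open Finset in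
theorem permBeta_eq_sum_sub {n : ℕ} (w : Equiv.Perm (Fin n)) :
    (permBeta w : ℤ)
      = ∑ i, ∑ j, if i < j ∧ w⁻¹ j < w⁻¹ i then (j : ℤ) - (i : ℤ) else 0 := by
  rw [permBeta, sum_filter, Fintype.sum_prod_type]
  push_cast
  refine sum_congr rfl fun i _ => sum_congr rfl fun j _ => ?_
  split_ifs with h
  · exact Nat.cast_sub (Fin.le_def.mp h.1.le)
  · rfl

open Finset in
theorem permBeta_inv_eq_sum_sub {n : ℕ} (w : Equiv.Perm (Fin n)) :
    (permBeta w⁻¹ : ℤ) = ∑ i, ∑ j,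
      if i < j ∧ w⁻¹ j < w⁻¹ i then (w⁻¹ i : ℤ) - (w⁻¹ j : ℤ) else 0 := by
  rw [permBeta_eq_sum_sub, sum_comm, ← Equiv.sum_comp w⁻¹]
  refine sum_congr rfl fun i _ => ?_
  rw [← Equiv.sum_comp w⁻¹]
  simp [and_comm]

/-- For every positive integer n and every permutation w of {1,…,n},
β(w) = β(w⁻¹). -/
theorem signed_bigrassmannian_stmt2 (n : ℕ) (hn : 0 < n) (w : Equiv.Perm (Fin n)) :
    permBeta w = permBeta w⁻¹ := by
  have h : (permBeta w : ℤ) - permBeta w⁻¹ = 0 := by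
    rw [permBeta_eq_sum_sub, permBeta_inv_eq_sum_sub, ← Finset.sum_sub_distrib]
    simp_rw [← Finset.sum_sub_distrib]
    calc _ = ∑ i, ∑ j, (if i < j ∧ w⁻¹ j < w⁻¹ i then
            ((j : ℤ) + (w⁻¹ j : ℤ)) - ((i : ℤ) + (w⁻¹ i : ℤ)) else 0) := by
          refine Finset.sum_congr rfl fun i _ => Finset.sum_congr rfl fun j _ => ?_
          split_ifs <;> ring
      _ = ∑ j : Fin n, ((j : ℤ) + (w⁻¹ j : ℤ)) * ((j : ℤ) - (w⁻¹ j : ℤ)) :=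
          sum_inversions_sub_s2 w⁻¹ fun j => (j : ℤ) + (w⁻¹ j : ℤ)
      _ = ∑ j : Fin n, (j : ℤ) ^ 2 - ∑ j : Fin n, (w⁻¹ j : ℤ) ^ 2 := by
          rw [← Finset.sum_sub_distrib]
          exact Finset.sum_congr rfl fun j _ => by ring
      _ = 0 := sub_eq_zero.mpr (Equiv.sum_comp w⁻¹ fun j : Fin n => (j : ℤ) ^ 2).symm
  exact_mod_cast sub_eq_zero.mp h
end

section
/- Let x₁,…,xₙ, λ, and q be commuting variables (elements of a commutative ring, or indeterminates of a multivariate polynomial ring over ℤ). Then ∏_{1≤i<j≤n} (x_i + λ q^{j−i} x_j) = Σ_{G ∈ T_n} λ^{ℓ(G)} q^{β(G)} ∏_{j=1}^{n} x_j^{ω_G(j)}, where the sum is over all tournaments G on {1,…,n}. -/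
/-- A tournament on {1,…,n}, encoded as `G : Fin n → Fin n → Bool` where
`G a b = true` means the edge is directed `a → b`. -/
def IsTournament {n : ℕ} (G : Fin n → Fin n → Bool) : Prop :=
  (∀ i : Fin n, G i i = false) ∧ ∀ i j : Fin n, i ≠ j → G i j = !G j i

instance {n : ℕ} : DecidablePred (IsTournament (n := n)) := fun _ => by
  unfold IsTournament; infer_instance

/-- The length ℓ(G): the number of inversions of `G`, i.e. directed edges `j → i`
with `j > i`. -/
def tLen {n : ℕ} (G : Fin n → Fin n → Bool) : ℕ :=
  (Finset.univ.filter (fun p : Fin n × Fin n => p.2 < p.1 ∧ G p.1 p.2 = true)).card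

/-- The bigrassmannian statistic β(G) = Σ_{j→i an inversion of G} (j−i). -/
def tBeta {n : ℕ} (G : Fin n → Fin n → Bool) : ℕ :=
  ∑ p ∈ Finset.univ.filter (fun p : Fin n × Fin n => p.2 < p.1 ∧ G p.1 p.2 = true),
    ((p.1 : ℕ) - (p.2 : ℕ))

/-- The outdegree `ω_G(j)` of a vertex `j` in `G`. -/
def outDeg {n : ℕ} (G : Fin n → Fin n → Bool) (j : Fin n) : ℕ :=
  (Finset.univ.filter (fun i : Fin n => G j i = true)).card

/-- The product of `x` over the tails of all edges of `G` collects each vertex with its outdegree. -/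
lemma prod_pow_outDeg {M : Type*} [CommMonoid M] {n : ℕ} (x : Fin n → M)
    (G : Fin n → Fin n → Bool) :
    ∏ j, x j ^ outDeg G j
      = ∏ p ∈ Finset.univ.filter (fun p : Fin n × Fin n => G p.1 p.2 = true), x p.1 := by
  rw [Finset.prod_filter, Fintype.prod_prod_type]
  refine Finset.prod_congr rfl fun j _ => ?_
  simp only [← Finset.prod_filter, Finset.prod_const, outDeg]

/-- The ascending edges and the inversions of a tournament partition its edges. -/
lemma IsTournament.prod_edges {M : Type*} [CommMonoid M] {n : ℕ} {G : Fin n → Fin n → Bool}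
    (hG : IsTournament G) (f : Fin n × Fin n → M) :
    ∏ p ∈ Finset.univ.filter (fun p : Fin n × Fin n => G p.1 p.2 = true), f p
      = (∏ p ∈ Finset.univ.filter (fun p : Fin n × Fin n => p.1 < p.2 ∧ G p.1 p.2 = true), f p)
        * ∏ p ∈ Finset.univ.filter (fun p : Fin n × Fin n => p.2 < p.1 ∧ G p.1 p.2 = true),
            f p := by
  rw [← Finset.prod_filter_mul_prod_filter_not _ (fun p : Fin n × Fin n => p.1 < p.2),
    Finset.filter_filter, Finset.filter_filter]
  congr 2 <;> ext ⟨a, b⟩ <;> simp only [Finset.mem_filter, Finset.mem_univ, true_and]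
  · exact and_comm
  · constructor
    · rintro ⟨h, hab⟩
      refine ⟨lt_of_le_of_ne (not_lt.mp hab) ?_, h⟩
      rintro rfl
      simp [hG.1] at h
    · rintro ⟨hab, h⟩
      exact ⟨h, hab.asymm⟩

/-- The pairs `i < j` that are not edges `i → j` of a tournament are the reversed inversions. -/
lemma IsTournament.prod_not_ascending {M : Type*} [CommMonoid M] {n : ℕ}
    {G : Fin n → Fin n → Bool} (hG : IsTournament G) (f : Fin n × Fin n → M) :
    ∏ p ∈ Finset.univ.filter (fun p : Fin n × Fin n => p.1 < p.2) \
        Finset.univ.filter (fun p : Fin n × Fin n => p.1 < p.2 ∧ G p.1 p.2 = true), f p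
      = ∏ p ∈ Finset.univ.filter (fun p : Fin n × Fin n => p.2 < p.1 ∧ G p.1 p.2 = true),
          f p.swap := by
  refine Finset.prod_nbij' Prod.swap Prod.swap ?_ ?_ (by simp) (by simp) (by simp)
  · rintro ⟨a, b⟩ h
    simp only [Finset.mem_sdiff, Finset.mem_filter, Finset.mem_univ, true_and] at h
    simp only [Finset.mem_filter, Finset.mem_univ, true_and, Prod.fst_swap, Prod.snd_swap]
    have := hG.2 b a h.1.ne'
    grind
  · rintro ⟨a, b⟩ h
    simp only [Finset.mem_filter, Finset.mem_univ, true_and] at h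
    simp only [Finset.mem_sdiff, Finset.mem_filter, Finset.mem_univ, true_and, Prod.fst_swap,
      Prod.snd_swap]
    have := hG.2 b a h.1.ne
    grind

/-- The weight of a tournament, as a product over ascending edges and inversions. -/
lemma IsTournament.prod_weight {R : Type*} [CommRing R] {n : ℕ} {G : Fin n → Fin n → Bool}
    (hG : IsTournament G) (x : Fin n → R) (lam q : R) :
    lam ^ tLen G * q ^ tBeta G * ∏ j : Fin n, x j ^ outDeg G j
      = (∏ p ∈ Finset.univ.filter (fun p : Fin n × Fin n => p.1 < p.2 ∧ G p.1 p.2 = true), x p.1)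
        * ∏ p ∈ Finset.univ.filter (fun p : Fin n × Fin n => p.1 < p.2) \
            Finset.univ.filter (fun p : Fin n × Fin n => p.1 < p.2 ∧ G p.1 p.2 = true),
            (lam * q ^ ((p.2 : ℕ) - (p.1 : ℕ)) * x p.2) := by
  rw [hG.prod_not_ascending, prod_pow_outDeg, hG.prod_edges]
  simp only [Prod.fst_swap, Prod.snd_swap, Finset.prod_mul_distrib, Finset.prod_const,
    Finset.prod_pow_eq_pow_sum]
  rw [tLen, tBeta]
  ring

/-- The tournament whose ascending edges are the ascending pairs in `t`. -/
def tournamentOfAscending {n : ℕ} (t : Finset (Fin n × Fin n)) (a b : Fin n) : Bool :=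
  if a < b then decide ((a, b) ∈ t) else if b < a then !decide ((b, a) ∈ t) else false

lemma isTournament_tournamentOfAscending {n : ℕ} (t : Finset (Fin n × Fin n)) :
    IsTournament (tournamentOfAscending t) := by
  refine ⟨fun i => by simp [tournamentOfAscending], fun i j hij => ?_⟩
  rcases hij.lt_or_gt with h | h <;> simp [tournamentOfAscending, h, h.asymm]

lemma IsTournament.tournamentOfAscending_eq {n : ℕ} {G : Fin n → Fin n → Bool}
    (hG : IsTournament G) :
    tournamentOfAscending
      (Finset.univ.filter (fun p : Fin n × Fin n => p.1 < p.2 ∧ G p.1 p.2 = true)) = G := by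
  funext a b
  rcases lt_trichotomy a b with h | rfl | h
  · simp [tournamentOfAscending, h]
  · simp [tournamentOfAscending, hG.1]
  · simp [tournamentOfAscending, h, h.asymm, hG.2 a b h.ne']

/-- in a commutative ring,
∏_{1≤i<j≤n} (x_i + λ q^{j−i} x_j) = Σ_{G ∈ T_n} λ^{ℓ(G)} q^{β(G)} ∏_j x_j^{ω_G(j)}. -/
theorem signed_bigrassmannian_stmt5 {R : Type*} [CommRing R] (n : ℕ)
    (x : Fin n → R) (lam q : R) :
    ∏ p ∈ Finset.univ.filter (fun p : Fin n × Fin n => p.1 < p.2),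
      (x p.1 + lam * q ^ ((p.2 : ℕ) - (p.1 : ℕ)) * x p.2)
      = ∑ G ∈ Finset.univ.filter (fun G : Fin n → Fin n → Bool => IsTournament G),
          lam ^ tLen G * q ^ tBeta G * ∏ j : Fin n, x j ^ outDeg G j := by
  rw [Finset.prod_add]
  symm
  refine Finset.sum_nbij'
    (fun G => Finset.univ.filter (fun p : Fin n × Fin n => p.1 < p.2 ∧ G p.1 p.2 = true))
    tournamentOfAscending ?_ ?_ ?_ ?_ ?_
  · intro G _
    rw [Finset.mem_powerset]
    exact Finset.monotone_filter_right _ fun p _ h => h.1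
  · intro t _
    simpa using isTournament_tournamentOfAscending t
  · intro G hG
    exact (Finset.mem_filter.mp hG).2.tournamentOfAscending_eq
  · intro t ht
    ext ⟨a, b⟩
    have hlt : (a, b) ∈ t → a < b := fun h => by simpa using Finset.mem_powerset.mp ht h
    by_cases hab : a < b
    · simp [tournamentOfAscending, hab]
    · simp [hab, mt hlt hab]
  · intro G hG
    exact (Finset.mem_filter.mp hG).2.prod_weight x lam q
end

section
/- Let G be a tournament on {1,…,n} and let i < j < k be vertices that form a 3-cycle in G (i.e., either k→j, j→i, i→k, or i→j, j→k, k→i). Let C_{ijk}(G) be the tournament obtained from G by reversing all three edges of this cycle and leaving all other edges unchanged. Then ℓ(C_{ijk}(G)) ∈ {ℓ(G)−1, ℓ(G)+1} and β(C_{ijk}(G)) = β(G). -/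
/-- `C_{ijk}(G)`: the tournament obtained from `G` by reversing all three edges
among the vertices `i, j, k` and leaving all other edges unchanged. -/
def revCycle {n : ℕ} (i j k : Fin n) (G : Fin n → Fin n → Bool) :
    Fin n → Fin n → Bool :=
  fun a b =>
    if (a = i ∨ a = j ∨ a = k) ∧ (b = i ∨ b = j ∨ b = k) ∧ a ≠ b then G b a
    else G a b

/-- A weighted sum over inversions splits into the contributions of the three edges of a
triangle and of the remaining edges. -/
theorem sum_inversions_eq_add_triangle {n : ℕ} (G : Fin n → Fin n → Bool) {i j k : Fin n}
    (hij : i < j) (hjk : j < k) (w : Fin n × Fin n → ℕ) :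
    ∑ p ∈ Finset.univ.filter (fun p : Fin n × Fin n => p.2 < p.1 ∧ G p.1 p.2 = true), w p =
      (((if G j i = true then w (j, i) else 0) + (if G k j = true then w (k, j) else 0)) +
        (if G k i = true then w (k, i) else 0)) +
      ∑ p ∈ ({(j, i), (k, j), (k, i)} : Finset (Fin n × Fin n))ᶜ,
        if p.2 < p.1 ∧ G p.1 p.2 = true then w p else 0 := by
  have hik := hij.trans hjk
  rw [Finset.sum_filter,
    ← Finset.sum_add_sum_compl ({(j, i), (k, j), (k, i)} : Finset (Fin n × Fin n)),
    Finset.sum_insert (by simp [hjk.ne]), Finset.sum_insert (by simp [hij.ne']),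
    Finset.sum_singleton]
  simp [hij, hjk, hik, add_assoc]

/-- Reversing a triangle does not change the contribution of the edges outside it. -/
theorem sum_inversions_off_triangle_revCycle {n : ℕ} (G : Fin n → Fin n → Bool) {i j k : Fin n}
    (hij : i < j) (hjk : j < k) (w : Fin n × Fin n → ℕ) :
    (∑ p ∈ ({(j, i), (k, j), (k, i)} : Finset (Fin n × Fin n))ᶜ,
        if p.2 < p.1 ∧ revCycle i j k G p.1 p.2 = true then w p else 0) =
      ∑ p ∈ ({(j, i), (k, j), (k, i)} : Finset (Fin n × Fin n))ᶜ,
        if p.2 < p.1 ∧ G p.1 p.2 = true then w p else 0 := by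
  refine Finset.sum_congr rfl fun ⟨a, b⟩ hp => ?_
  simp only [Finset.mem_compl, Finset.mem_insert, Finset.mem_singleton, Prod.mk.injEq] at hp
  by_cases hab : b < a
  · have : revCycle i j k G a b = G a b := if_neg (by omega)
    simp only [this]
  · simp [hab]

/-- if `i < j < k` form a 3-cycle in a tournament `G`, then
ℓ(C_{ijk}(G)) ∈ {ℓ(G)−1, ℓ(G)+1} and β(C_{ijk}(G)) = β(G). -/
theorem signed_bigrassmannian_stmt6 {n : ℕ} (G : Fin n → Fin n → Bool)
    (hG : IsTournament G) (i j k : Fin n) (hij : i < j) (hjk : j < k)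
    (hcyc : (G k j = true ∧ G j i = true ∧ G i k = true) ∨
            (G i j = true ∧ G j k = true ∧ G k i = true)) :
    (tLen (revCycle i j k G) + 1 = tLen G ∨ tLen (revCycle i j k G) = tLen G + 1) ∧
    tBeta (revCycle i j k G) = tBeta G := by
  obtain ⟨-, hG⟩ := hG
  have hik := hij.trans hjk
  have hne := hij.ne
  have hne' := hjk.ne
  have hne'' := hik.ne
  have hji := hG j i hij.ne'
  have hkj := hG k j hjk.ne'
  have hki := hG k i hik.ne'
  have hrji : revCycle i j k G j i = G i j := by simp [revCycle, hne.symm]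
  have hrkj : revCycle i j k G k j = G j k := by simp [revCycle, hne'.symm]
  have hrki : revCycle i j k G k i = G i k := by simp [revCycle, hne''.symm]
  have hrest (w : Fin n × Fin n → ℕ) := sum_inversions_off_triangle_revCycle G hij hjk w
  have hij' : (i : ℕ) < j := hij
  have hjk' : (j : ℕ) < k := hjk
  constructor
  · rw [tLen, tLen, Finset.card_eq_sum_ones, Finset.card_eq_sum_ones,
      sum_inversions_eq_add_triangle (revCycle i j k G) hij hjk,
      sum_inversions_eq_add_triangle G hij hjk, hrest, hrji, hrkj, hrki]
    rcases hcyc with ⟨h₁, h₂, h₃⟩ | ⟨h₁, h₂, h₃⟩ <;> simp_all <;> omega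
  · rw [tBeta, tBeta, sum_inversions_eq_add_triangle (revCycle i j k G) hij hjk,
      sum_inversions_eq_add_triangle G hij hjk, hrest, hrji, hrkj, hrki]
    rcases hcyc with ⟨h₁, h₂, h₃⟩ | ⟨h₁, h₂, h₃⟩ <;> simp_all <;> omega
end

section
/- For every positive integer n, the signed sum over all non-transitive tournaments on {1,…,n} vanishes: Σ_{G ∈ T_n, G not transitive} (−1)^{ℓ(G)} q^{β(G)} = 0 in the polynomial ring ℤ[q]. -/
/-- A tournament is transitive if it contains no 3-cycle. -/
def IsTransitiveTournament {n : ℕ} (G : Fin n → Fin n → Bool) : Prop :=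
  ¬ ∃ a b c : Fin n, G a b = true ∧ G b c = true ∧ G c a = true

instance {n : ℕ} : DecidablePred (IsTransitiveTournament (n := n)) := fun _ => by
  unfold IsTransitiveTournament; infer_instance

/-- The score (out-degree) of the vertex `v`. -/
def tScore {n : ℕ} (G : Fin n → Fin n → Bool) (v : Fin n) : ℕ :=
  (Finset.univ.filter (fun u => G v u = true)).card

lemma tScore_lt {n : ℕ} {G : Fin n → Fin n → Bool} (hG : IsTournament G) (v : Fin n) :
    tScore G v < n := by
  have h : Finset.univ.filter (fun u => G v u = true) ⊂ Finset.univ := by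
    rw [Finset.ssubset_univ_iff]
    intro h
    have hv : v ∈ Finset.univ.filter (fun u => G v u = true) := 
      Finset.eq_univ_iff_forall.mp h v
    simp [hG.1 v] at hv
  simpa [tScore] using Finset.card_lt_card h

lemma card_tScore_lt {n : ℕ} {G : Fin n → Fin n → Bool} (hG : IsTournament G)
    (hinj : Function.Injective (tScore G)) (v : Fin n) :
    (Finset.univ.filter (fun u => tScore G u < tScore G v)).card = tScore G v := by
  let e : Fin n → Fin n := fun u => ⟨tScore G u, tScore_lt hG u⟩
  have he : Function.Bijective e :=
    Finite.injective_iff_bijective.mp fun a b h => hinj (congrArg Fin.val h)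
  calc (Finset.univ.filter (fun u => tScore G u < tScore G v)).card
      = (Finset.Iio (e v)).card := by
        refine Finset.card_bijective e he fun u => ?_
        simp [e]
    _ = tScore G v := by simp [e]

lemma edge_iff_tScore_lt {n : ℕ} {G : Fin n → Fin n → Bool} (hG : IsTournament G)
    (hinj : Function.Injective (tScore G)) (m : ℕ) :
    ∀ v : Fin n, tScore G v = m → ∀ u, G v u = true ↔ tScore G u < tScore G v := by
  induction m using Nat.strong_induction_on with
  | _ m ih =>
    intro v hv u
    have hsub : Finset.univ.filter (fun u => tScore G u < tScore G v) ⊆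
        Finset.univ.filter (fun u => G v u = true) := by
      intro w hw
      simp only [Finset.mem_filter, Finset.mem_univ, true_and] at hw ⊢
      have hne : v ≠ w := by rintro rfl; exact lt_irrefl _ hw
      have hwv : ¬ G w v = true := by
        rw [ih _ (hv ▸ hw) w rfl v]
        exact hw.not_gt
      rw [hG.2 v w hne]
      simpa using hwv
    have heq := Finset.eq_of_subset_of_card_le hsub (card_tScore_lt hG hinj v).ge
    have := Finset.ext_iff.mp heq u
    simpa using this.symm

lemma isTransitiveTournament_of_injective_tScore {n : ℕ} {G : Fin n → Fin n → Bool}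
    (hG : IsTournament G) (hinj : Function.Injective (tScore G)) :
    IsTransitiveTournament G := by
  rintro ⟨a, b, c, hab, hbc, hca⟩
  rw [edge_iff_tScore_lt hG hinj _ _ rfl] at hab hbc hca
  omega

lemma tBeta_add_sum {n : ℕ} {G : Fin n → Fin n → Bool} (hG : IsTournament G) :
    tBeta G + ∑ p : Fin n × Fin n, (if p.2 < p.1 then (p.2 : ℕ) else 0) =
      ∑ v : Fin n, (v : ℕ) * tScore G v := by
  have h1 : ∑ v : Fin n, (v : ℕ) * tScore G v =
      ∑ p : Fin n × Fin n, (if G p.1 p.2 = true then (p.1 : ℕ) else 0) := by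
    rw [Fintype.sum_prod_type]
    refine Finset.sum_congr rfl fun v _ => ?_
    simp [← Finset.sum_filter, tScore, mul_comm]
  have h2 : ∑ p : Fin n × Fin n, (if G p.1 p.2 = true then (p.1 : ℕ) else 0) =
      ∑ p : Fin n × Fin n, (if p.2 < p.1 ∧ G p.1 p.2 = true then (p.1 : ℕ) else 0) +
      ∑ p : Fin n × Fin n, (if p.1 < p.2 ∧ G p.1 p.2 = true then (p.1 : ℕ) else 0) := by
    rw [← Finset.sum_add_distrib]
    refine Finset.sum_congr rfl fun p _ => ?_
    obtain ⟨a, b⟩ := p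
    rcases lt_trichotomy a b with h | rfl | h
    · simp [h, h.not_gt]
    · simp [hG.1 a]
    · simp [h, h.not_gt]
  have h3 : ∑ p : Fin n × Fin n, (if p.1 < p.2 ∧ G p.1 p.2 = true then (p.1 : ℕ) else 0) =
      ∑ p : Fin n × Fin n, (if p.2 < p.1 ∧ G p.2 p.1 = true then (p.2 : ℕ) else 0) :=
    (Equiv.sum_comp (Equiv.prodComm (Fin n) (Fin n)) _).symm
  rw [h1, h2, h3, tBeta, Finset.sum_filter, ← Finset.sum_add_distrib, ← Finset.sum_add_distrib]
  refine Finset.sum_congr rfl fun p _ => ?_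
  obtain ⟨a, b⟩ := p
  by_cases h : b < a
  · have h' : (b : ℕ) < a := h
    have hab := hG.2 b a h.ne
    cases hv : G a b <;> simp [h, hab, hv]
    omega
  · simp [h]

lemma tBeta_eq_of_tScore_eq {n : ℕ} {G H : Fin n → Fin n → Bool} (hG : IsTournament G)
    (hH : IsTournament H) (h : tScore G = tScore H) : tBeta G = tBeta H := by
  have hG' := tBeta_add_sum hG
  have hH' := tBeta_add_sum hH
  rw [h] at hG'
  omega

/-- The antisymmetric sign of the edge between `a` and `b`, equal to `-1` if `b → a`. -/
noncomputable def edgeSign {n : ℕ} (G : Fin n → Fin n → Bool) (a b : Fin n) : Polynomial ℤ :=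
  if a = b then 0 else if G b a = true then -1 else 1

lemma edgeSign_antisymm {n : ℕ} {G : Fin n → Fin n → Bool} (hG : IsTournament G)
    (a b : Fin n) : edgeSign G a b = -edgeSign G b a := by
  by_cases h : a = b
  · simp [edgeSign, h]
  · have hab := hG.2 a b h
    cases hv : G b a <;> simp [edgeSign, h, Ne.symm h, hab, hv]

lemma neg_one_pow_tLen {n : ℕ} (G : Fin n → Fin n → Bool) :
    (-1 : Polynomial ℤ) ^ tLen G = ∏ j : Fin n, ∏ i ∈ Finset.Iio j, edgeSign G i j := by
  rw [tLen, ← Finset.prod_const, Finset.prod_filter, Fintype.prod_prod_type]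
  refine Finset.prod_congr rfl fun j _ => ?_
  have hIio : Finset.Iio j = Finset.univ.filter (fun i => i < j) := by ext; simp
  rw [hIio, Finset.prod_filter]
  refine Finset.prod_congr rfl fun i _ => ?_
  by_cases h : i < j
  · simp [edgeSign, h, h.ne]
  · simp [h]

/-- The tournament obtained from `G` by relabelling the vertices along `σ`. -/
def relabel {n : ℕ} (σ : Equiv.Perm (Fin n)) (G : Fin n → Fin n → Bool) :
    Fin n → Fin n → Bool :=
  fun a b => G (σ a) (σ b)

lemma IsTournament.relabel {n : ℕ} {G : Fin n → Fin n → Bool} (hG : IsTournament G)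
    (σ : Equiv.Perm (Fin n)) : IsTournament (relabel σ G) :=
  ⟨fun i => hG.1 (σ i), fun _ _ h => hG.2 _ _ (σ.injective.ne h)⟩

lemma isTransitiveTournament_of_relabel {n : ℕ} {G : Fin n → Fin n → Bool}
    {σ : Equiv.Perm (Fin n)} (h : IsTransitiveTournament (relabel σ G)) :
    IsTransitiveTournament G := by
  rintro ⟨a, b, c, hab, hbc, hca⟩
  exact h ⟨σ.symm a, σ.symm b, σ.symm c, by simpa [relabel] using ⟨hab, hbc, hca⟩⟩

lemma tScore_relabel {n : ℕ} (G : Fin n → Fin n → Bool) (σ : Equiv.Perm (Fin n)) (v : Fin n) :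
    tScore (relabel σ G) v = tScore G (σ v) := by
  unfold tScore
  exact Finset.card_bijective σ σ.bijective fun u => by
    simp only [Finset.mem_filter, Finset.mem_univ, true_and]
    rfl

lemma neg_one_pow_tLen_relabel {n : ℕ} {G : Fin n → Fin n → Bool} (hG : IsTournament G)
    (σ : Equiv.Perm (Fin n)) :
    (-1 : Polynomial ℤ) ^ tLen (relabel σ G) = σ.sign * (-1 : Polynomial ℤ) ^ tLen G := by
  rw [neg_one_pow_tLen, neg_one_pow_tLen,
    ← σ.prod_Iio_comp_eq_sign_mul_prod (edgeSign_antisymm hG)]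
  refine Finset.prod_congr rfl fun j _ => Finset.prod_congr rfl fun i _ => ?_
  by_cases h : i = j
  · simp [edgeSign, h]
  · simp only [edgeSign, h, EmbeddingLike.apply_eq_iff_eq, if_false]
    rfl

/-- the signed sum over all non-transitive tournaments vanishes:
Σ_{G ∈ T_n, G not transitive} (−1)^{ℓ(G)} q^{β(G)} = 0 in ℤ[q]. -/
theorem signed_bigrassmannian_stmt7 (n : ℕ) (hn : 0 < n) :
    ∑ G ∈ Finset.univ.filter
        (fun G : Fin n → Fin n → Bool => IsTournament G ∧ ¬ IsTransitiveTournament G),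
      (-1 : Polynomial ℤ) ^ tLen G * Polynomial.X ^ tBeta G = 0 := by
  rw [← Finset.sum_fiberwise_of_maps_to (g := tScore)
    (fun G hG => Finset.mem_image_of_mem tScore hG)]
  refine Finset.sum_eq_zero fun s hs => ?_
  obtain ⟨G₀, hG₀, rfl⟩ := Finset.mem_image.mp hs
  simp only [Finset.mem_filter, Finset.mem_univ, true_and] at hG₀
  obtain ⟨a, b, hab, hne⟩ : ∃ a b, tScore G₀ a = tScore G₀ b ∧ a ≠ b :=
    Function.not_injective_iff.mp
      (mt (isTransitiveTournament_of_injective_tScore hG₀.1) hG₀.2)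
  have hscore : ∀ G : Fin n → Fin n → Bool, tScore G = tScore G₀ →
      tScore (relabel (Equiv.swap a b) G) = tScore G₀ := by
    intro G hG
    funext v
    rw [tScore_relabel, hG, Equiv.swap_apply_def]
    split_ifs with h1 h2
    · rw [h1, hab]
    · rw [h2, hab]
    · rfl
  have hsign : ∀ G : Fin n → Fin n → Bool, IsTournament G →
      (-1 : Polynomial ℤ) ^ tLen (relabel (Equiv.swap a b) G) = -(-1) ^ tLen G := by
    intro G hG
    rw [neg_one_pow_tLen_relabel hG, Equiv.Perm.sign_swap hne]
    simp
  refine Finset.sum_involution (fun G _ => relabel (Equiv.swap a b) G) ?_ ?_ ?_ ?_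
  · intro G hG
    simp only [Finset.mem_filter, Finset.mem_univ, true_and] at hG
    rw [hsign G hG.1.1, tBeta_eq_of_tScore_eq (hG.1.1.relabel _) hG.1.1
      ((hscore G hG.2).trans hG.2.symm)]
    ring
  · intro G hG _ heq
    simp only [Finset.mem_filter, Finset.mem_univ, true_and] at hG
    have h := hsign G hG.1.1
    rw [heq] at h
    exact pow_ne_zero _ (by simp) (self_eq_neg.mp h)
  · intro G hG
    simp only [Finset.mem_filter, Finset.mem_univ, true_and] at hG ⊢
    exact ⟨⟨hG.1.1.relabel _, mt isTransitiveTournament_of_relabel hG.1.2⟩, hscore G hG.2⟩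
  · intro G _
    funext u v
    simp [relabel]
end

section
/- For every positive integer n, the identity Σ_{w ∈ S_n} (−1)^{ℓ(w)} q^{β(w)} = ∏_{k=1}^{n−1} (1 − q^k)^{n−k} holds in the polynomial ring ℤ[q]. -/
/-- The length ℓ(w) = |N(w)|, the number of inversions of `w`, where
N(w) = {(i,j) : i < j and w⁻¹(i) > w⁻¹(j)}. -/
def permLen {n : ℕ} (w : Equiv.Perm (Fin n)) : ℕ :=
  (Finset.univ.filter
    (fun p : Fin n × Fin n => p.1 < p.2 ∧ w⁻¹ p.2 < w⁻¹ p.1)).card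

theorem permBeta_eq_sum {n : ℕ} (w : Equiv.Perm (Fin n)) :
    (permBeta w : ℤ) = ∑ i : Fin n, ∑ j : Fin n,
      if i < j ∧ w⁻¹ j < w⁻¹ i then ((j : ℤ) - (i : ℤ)) else 0 := by
  unfold permBeta
  rw [Nat.cast_sum, Finset.sum_filter, ← Finset.univ_product_univ, Finset.sum_product]
  refine Finset.sum_congr rfl fun i _ => Finset.sum_congr rfl fun j _ => ?_
  by_cases h : i < j ∧ w⁻¹ j < w⁻¹ i
  · have : (i : ℕ) ≤ j := h.1.le
    simp only [if_pos h, Nat.cast_sub this]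
  · simp only [if_neg h]

theorem Fin.sum_ite_lt_perm {n : ℕ} (u : Equiv.Perm (Fin n)) (i : Fin n) :
    ∑ k : Fin n, (if u k < u i then (1 : ℤ) else 0) = (u i : ℕ) := by
  rw [Equiv.sum_comp u (fun k => if k < u i then (1 : ℤ) else 0), Finset.sum_boole]
  simp [Finset.filter_gt_eq_Iio]

theorem permBeta_eq_sum_mul_sub {n : ℕ} (w : Equiv.Perm (Fin n)) :
    (permBeta w : ℤ) = ∑ i : Fin n, (i : ℤ) * ((i : ℤ) - (w⁻¹ i : ℕ)) := by
  have hsub (i : Fin n) : (i : ℤ) * ((i : ℤ) - (w⁻¹ i : ℕ)) =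
      ∑ k : Fin n, ((if k < i ∧ w⁻¹ i < w⁻¹ k then (i : ℤ) else 0) -
        if i < k ∧ w⁻¹ k < w⁻¹ i then (i : ℤ) else 0) := by
    have h₁ := Fin.sum_ite_lt_perm 1 i
    rw [Equiv.Perm.one_apply] at h₁
    rw [← h₁, ← Fin.sum_ite_lt_perm w⁻¹ i, ← Finset.sum_sub_distrib, h₁, Finset.mul_sum]
    refine Finset.sum_congr rfl fun k _ => ?_
    have hinj : w⁻¹ k = w⁻¹ i ↔ k = i := w⁻¹.injective.eq_iff
    simp only [Equiv.Perm.one_apply]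
    grind
  rw [permBeta_eq_sum, Finset.sum_congr rfl fun i _ => hsub i]
  simp only [Finset.sum_sub_distrib]
  conv_rhs => rw [Finset.sum_comm]
  simp only [← Finset.sum_sub_distrib]
  refine Finset.sum_congr rfl fun i _ => Finset.sum_congr rfl fun j _ => ?_
  split_ifs <;> simp

theorem permBeta_add_sum {n : ℕ} (w : Equiv.Perm (Fin n)) :
    permBeta w + ∑ i : Fin n, (i : ℕ) * (n - 1) =
      ∑ i : Fin n, (i : ℕ) ^ 2 + ∑ i : Fin n, (w i : ℕ) * (Fin.rev i : ℕ) := by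
  have hrev (i : Fin n) : ((Fin.rev i : ℕ) : ℤ) = ((n - 1 : ℕ) : ℤ) - (i : ℕ) := by
    have := i.isLt
    rw [Fin.val_rev]
    omega
  have hw : ∑ i : Fin n, (i : ℤ) * (w⁻¹ i : ℕ) = ∑ i : Fin n, (w i : ℤ) * (i : ℕ) := by
    rw [← Equiv.sum_comp w]
    simp
  have hw' : ∑ i : Fin n, (w i : ℤ) = ∑ i : Fin n, (i : ℤ) :=
    Equiv.sum_comp w fun i : Fin n => (i : ℤ)
  zify
  simp only [hrev, permBeta_eq_sum_mul_sub, mul_sub, Finset.sum_sub_distrib, hw,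
    ← Finset.sum_mul, hw', sq]
  ring

theorem neg_one_pow_permLen {n : ℕ} (w : Equiv.Perm (Fin n)) :
    (-1 : Polynomial ℤ) ^ permLen w = ((Equiv.Perm.sign w : ℤ) : Polynomial ℤ) := by
  have h : (Equiv.Perm.sign w : ℤ) = (-1) ^ permLen w := by
    rw [← Equiv.Perm.sign_inv, Equiv.Perm.sign_eq_prod_prod_Ioi, permLen,
      ← Finset.prod_const, Finset.prod_filter, ← Finset.univ_product_univ,
      Finset.prod_product]
    push_cast
    refine Finset.prod_congr rfl fun i _ => ?_
    rw [← Finset.filter_lt_eq_Ioi, Finset.prod_filter]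
    refine Finset.prod_congr rfl fun j _ => ?_
    have hinj : w⁻¹ i = w⁻¹ j ↔ i = j := w⁻¹.injective.eq_iff
    simp only [apply_ite Units.val, Units.val_one, Units.val_neg]
    grind
  rw [h]
  push_cast
  rfl

theorem prod_Ioi_one_sub_X_pow (n : ℕ) :
    ∏ i : Fin n, ∏ j ∈ Finset.Ioi i, (1 - (Polynomial.X : Polynomial ℤ) ^ ((j : ℕ) - (i : ℕ))) =
      ∏ k ∈ Finset.Icc 1 (n - 1), (1 - Polynomial.X ^ k) ^ (n - k) := by
  have hrow (n : ℕ) : ∏ j : Fin n, (1 - (Polynomial.X : Polynomial ℤ) ^ ((j : ℕ) + 1)) =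
      ∏ k ∈ Finset.Icc 1 n, (1 - Polynomial.X ^ k) := by
    rw [Fin.prod_univ_eq_prod_range (fun j => 1 - (Polynomial.X : Polynomial ℤ) ^ (j + 1)) n,
      Finset.range_eq_Ico, Finset.prod_Ico_add' (fun j => 1 - (Polynomial.X : Polynomial ℤ) ^ j)]
    rfl
  induction n with
  | zero => simp
  | succ n ih =>
    rw [Fin.prod_univ_succ, Fin.prod_Ioi_zero]
    simp only [Fin.prod_Ioi_succ, Fin.val_succ, Fin.val_zero, Nat.add_sub_add_right,
      Nat.sub_zero, Nat.add_sub_cancel, ih, hrow]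
    have hext : ∏ k ∈ Finset.Icc 1 (n - 1), (1 - (Polynomial.X : Polynomial ℤ) ^ k) ^ (n - k) =
        ∏ k ∈ Finset.Icc 1 n, (1 - (Polynomial.X : Polynomial ℤ) ^ k) ^ (n - k) := by
      refine Finset.prod_subset (Finset.Icc_subset_Icc_right (Nat.sub_le n 1)) fun k hk hk' => ?_
      rw [Finset.mem_Icc] at hk hk'
      rw [show n - k = 0 by omega, pow_zero]
    rw [hext, ← Finset.prod_mul_distrib]
    refine Finset.prod_congr rfl fun k hk => ?_
    rw [Nat.succ_sub (Finset.mem_Icc.1 hk).2, pow_succ']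

theorem det_projVandermonde_X_pow (n : ℕ) :
    (Matrix.projVandermonde (fun _ : Fin n => (1 : Polynomial ℤ))
        fun i : Fin n => Polynomial.X ^ (i : ℕ)).det =
      Polynomial.X ^ (∑ i : Fin n, (i : ℕ) * (Fin.rev i : ℕ)) *
        ∏ k ∈ Finset.Icc 1 (n - 1), (1 - Polynomial.X ^ k) ^ (n - k) := by
  rw [Matrix.det_projVandermonde, ← prod_Ioi_one_sub_X_pow, ← Finset.prod_pow_eq_pow_sum,
    ← Finset.prod_mul_distrib]
  refine Finset.prod_congr rfl fun i _ => ?_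
  have hcard : (Fin.rev i : ℕ) = (Finset.Ioi i).card := by
    rw [Fin.card_Ioi, Fin.val_rev]
    omega
  rw [pow_mul, hcard, ← Finset.prod_const, ← Finset.prod_mul_distrib]
  refine Finset.prod_congr rfl fun j hj => ?_
  have hij : (i : ℕ) ≤ j := (Finset.mem_Ioi.1 hj).le
  rw [one_mul, one_mul, mul_sub, mul_one, ← pow_add, Nat.add_sub_cancel' hij]

/-- for every positive integer n,
Σ_{w ∈ S_n} (−1)^{ℓ(w)} q^{β(w)} = ∏_{k=1}^{n−1} (1 − q^k)^{n−k} in ℤ[q]. -/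
theorem signed_bigrassmannian_stmt8 (n : ℕ) (hn : 0 < n) :
    ∑ w : Equiv.Perm (Fin n),
      (-1 : Polynomial ℤ) ^ permLen w * Polynomial.X ^ permBeta w
      = ∏ k ∈ Finset.Icc 1 (n - 1), (1 - Polynomial.X ^ k) ^ (n - k) := by
  have hdet : (∑ w : Equiv.Perm (Fin n),
      (-1 : Polynomial ℤ) ^ permLen w * Polynomial.X ^ permBeta w) *
        Polynomial.X ^ (∑ i : Fin n, (i : ℕ) * (n - 1)) =
      Polynomial.X ^ (∑ i : Fin n, (i : ℕ) ^ 2) *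
        (Matrix.projVandermonde (fun _ : Fin n => (1 : Polynomial ℤ))
          fun i : Fin n => Polynomial.X ^ (i : ℕ)).det := by
    rw [Matrix.det_apply', Finset.sum_mul, Finset.mul_sum]
    refine Finset.sum_congr rfl fun w _ => ?_
    rw [mul_assoc, ← pow_add, permBeta_add_sum, neg_one_pow_permLen, pow_add,
      ← Finset.prod_pow_eq_pow_sum Finset.univ (fun i => (w i : ℕ) * (Fin.rev i : ℕ))]
    simp only [Matrix.projVandermonde_apply, one_pow, one_mul, ← pow_mul]
    ring
  have hexp : ∑ i : Fin n, (i : ℕ) ^ 2 + ∑ i : Fin n, (i : ℕ) * (Fin.rev i : ℕ) =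
      ∑ i : Fin n, (i : ℕ) * (n - 1) := by
    rw [← Finset.sum_add_distrib]
    refine Finset.sum_congr rfl fun i _ => ?_
    rw [sq, ← mul_add, Fin.val_rev]
    congr 1
    omega
  rw [det_projVandermonde_X_pow, ← mul_assoc, ← pow_add, hexp, mul_comm] at hdet
  exact mul_left_cancel₀ (pow_ne_zero _ Polynomial.X_ne_zero) hdet
end
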